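/- arXiv:1708.05338 — 2 statements merged into one kernel-verified Lean document; each statement's English description precedes it below -/
import Mathlib

section
/- Fix n ∈ ℕ₊. Let f ∈ ℂ[X₁, …, Xₙ] and k ∈ ℕ. Let ℳ = (M₁, …, Mₙ) be a ∗-closed tuple of d×d complex matrices and let x ∈ ℂ^d be such that ℳ is (2k·deg(f))-commutative at x. Then [f*(ℳ*) f(ℳ)]^k (x) = [f*(ℳ*)]^k [f(ℳ)]^k (x), where ℳ* := (M₁*, …, Mₙ*). -/
open Matrix MvPolynomial

/-- `f(ℳ)`: the evaluation at a matrix tuple `ℳ` of the noncommutative lift `c(f)` of a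
commutative polynomial `f`, obtained by writing each monomial of `f` with the variables in
increasing order. -/
noncomputable def evalSorted {n d : ℕ} (M : Fin n → Matrix (Fin d) (Fin d) ℂ)
    (f : MvPolynomial (Fin n) ℂ) : Matrix (Fin d) (Fin d) ℂ :=
  ∑ s ∈ f.support, f.coeff s • (List.ofFn fun i : Fin n => (M i) ^ (s i)).prod

/-- `f*(ℳ)`: the evaluation at a matrix tuple `ℳ` of `c(f)*`, where the `∗`-operation on
noncommutative polynomials conjugates coefficients and reverses words. -/
noncomputable def evalSortedStar {n d : ℕ} (M : Fin n → Matrix (Fin d) (Fin d) ℂ)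
    (f : MvPolynomial (Fin n) ℂ) : Matrix (Fin d) (Fin d) ℂ :=
  ∑ s ∈ f.support,
    (starRingEnd ℂ) (f.coeff s) • ((List.ofFn fun i : Fin n => (M i) ^ (s i)).reverse).prod

/-- `ℳ_α` for a word `α : [q] → [n]` of matrices: the product `M_{α 0} ⋯ M_{α (q-1)}`. -/
noncomputable def mwordM {n d : ℕ} (M : Fin n → Matrix (Fin d) (Fin d) ℂ) {q : ℕ}
    (α : Fin q → Fin n) : Matrix (Fin d) (Fin d) ℂ :=
  (List.ofFn fun j => M (α j)).prod

/-- `ℳ` is `r`-commutative at `x`: for every word `α` of length `q ≤ r` and every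
permutation `σ` of `[q]`, `ℳ_α(x) = ℳ_{α∘σ}(x)`. -/
def RCommAt {n d : ℕ} (M : Fin n → Matrix (Fin d) (Fin d) ℂ) (r : ℕ) (x : Fin d → ℂ) : Prop :=
  ∀ (q : ℕ), q ≤ r → ∀ (α : Fin q → Fin n) (σ : Equiv.Perm (Fin q)),
    (mwordM M α).mulVec x = (mwordM M (α ∘ σ)).mulVec x

def wordSpan {n d : ℕ} (M : Fin n → Matrix (Fin d) (Fin d) ℂ) (a : ℕ) :
    Submodule ℂ (Matrix (Fin d) (Fin d) ℂ) :=
  Submodule.span ℂ {A | ∃ L : List (Fin n), L.length ≤ a ∧ A = (L.map M).prod}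

lemma wordSpan_mono {n d : ℕ} (M : Fin n → Matrix (Fin d) (Fin d) ℂ) {a b : ℕ} (h : a ≤ b) :
    wordSpan M a ≤ wordSpan M b := by
  apply Submodule.span_mono
  rintro A ⟨L, hL, rfl⟩
  exact ⟨L, hL.trans h, rfl⟩

lemma wordSpan_mul {n d : ℕ} (M : Fin n → Matrix (Fin d) (Fin d) ℂ) {a b : ℕ}
    {A B : Matrix (Fin d) (Fin d) ℂ} (hA : A ∈ wordSpan M a) (hB : B ∈ wordSpan M b) :
    A * B ∈ wordSpan M (a + b) := by
  have h := Submodule.mul_mem_mul hA hB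
  unfold wordSpan at h
  rw [Submodule.span_mul_span] at h
  refine Submodule.span_mono ?_ h
  rintro _ ⟨_, ⟨L, hL, rfl⟩, _, ⟨K, hK, rfl⟩, rfl⟩
  exact ⟨L ++ K, by simp; omega, by simp⟩

lemma wordSpan_one {n d : ℕ} (M : Fin n → Matrix (Fin d) (Fin d) ℂ) (a : ℕ) :
    1 ∈ wordSpan M a :=
  Submodule.subset_span ⟨[], by simp, by simp⟩

lemma wordSpan_pow {n d : ℕ} (M : Fin n → Matrix (Fin d) (Fin d) ℂ) {a : ℕ}
    {A : Matrix (Fin d) (Fin d) ℂ} (hA : A ∈ wordSpan M a) (k : ℕ) :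
    A ^ k ∈ wordSpan M (k * a) := by
  induction k with
  | zero => simpa using wordSpan_one M _
  | succ k ih =>
    rw [pow_succ, Nat.succ_mul]
    exact wordSpan_mul M ih hA

lemma wordSpan_list {n d : ℕ} (M : Fin n → Matrix (Fin d) (Fin d) ℂ) {ι : Type}
    (A : ι → Matrix (Fin d) (Fin d) ℂ) (a : ι → ℕ) (h : ∀ i, A i ∈ wordSpan M (a i))
    (l : List ι) : (l.map A).prod ∈ wordSpan M (l.map a).sum := by
  induction l with
  | nil => simpa using wordSpan_one M _
  | cons i l ih =>
    simp only [List.map_cons, List.prod_cons, List.sum_cons]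
    exact wordSpan_mul M (h i) ih

lemma words_perm {n d : ℕ} {M : Fin n → Matrix (Fin d) (Fin d) ℂ} {r : ℕ} {x : Fin d → ℂ}
    (hc : RCommAt M r x) {q : ℕ} (hq : q ≤ r) (L K : List (Fin n)) (hL : L.length = q)
    (h : L.Perm K) : (L.map M).prod.mulVec x = (K.map M).prod.mulVec x := by
  have hK : K.length = q := h.length_eq ▸ hL
  obtain ⟨α, rfl⟩ : ∃ α : Fin q → Fin n, L = List.ofFn α := by
    subst hL; exact ⟨L.get, by simp⟩
  obtain ⟨β, rfl⟩ : ∃ β : Fin q → Fin n, K = List.ofFn β := by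
    subst hK; exact ⟨K.get, by simp⟩
  have h2 : List.ofFn (α ∘ Tuple.sort α) = List.ofFn (β ∘ Tuple.sort β) :=
    List.Perm.eq_of_pairwise' (Tuple.monotone_sort α).sortedLE_ofFn.pairwise
      (Tuple.monotone_sort β).sortedLE_ofFn.pairwise
      (((Tuple.sort α).ofFn_comp_perm α).trans (h.trans ((Tuple.sort β).ofFn_comp_perm β).symm))
  have h3 := List.ofFn_injective h2
  have e1 := hc q hq α (Tuple.sort α)
  have e2 := hc q hq β (Tuple.sort β)
  rw [h3, ← e2] at e1
  simpa [mwordM, List.map_ofFn, Function.comp_def] using e1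

lemma wordSpan_comm {n d : ℕ} {M : Fin n → Matrix (Fin d) (Fin d) ℂ} {r : ℕ} {x : Fin d → ℂ}
    (hc : RCommAt M r x) {a b c : ℕ} (hq : a + b + c ≤ r) {A B C : Matrix (Fin d) (Fin d) ℂ}
    (hA : A ∈ wordSpan M a) (hB : B ∈ wordSpan M b) (hC : C ∈ wordSpan M c) :
    (A * B * C).mulVec x = (B * A * C).mulVec x := by
  induction hA using Submodule.span_induction with
  | zero => simp
  | add A A' _ _ h h' => simp only [add_mul, mul_add, Matrix.add_mulVec, h, h']
  | smul t A _ h => simp only [smul_mul_assoc, mul_smul_comm, Matrix.smul_mulVec, h]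
  | mem A hA =>
  induction hB using Submodule.span_induction with
  | zero => simp
  | add A A' _ _ h h' => simp only [add_mul, mul_add, Matrix.add_mulVec, h, h']
  | smul t A _ h => simp only [smul_mul_assoc, mul_smul_comm, Matrix.smul_mulVec, h]
  | mem B hB =>
  induction hC using Submodule.span_induction with
  | zero => simp
  | add A A' _ _ h h' => simp only [mul_add, Matrix.add_mulVec, h, h']
  | smul t A _ h => simp only [mul_smul_comm, Matrix.smul_mulVec, h]
  | mem C hC =>
  obtain ⟨L, hL, rfl⟩ := hA
  obtain ⟨K, hK, rfl⟩ := hB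
  obtain ⟨J, hJ, rfl⟩ := hC
  have := words_perm hc (q := (L ++ K ++ J).length) (by simp; omega) (L ++ K ++ J) (K ++ L ++ J) rfl
    (List.perm_append_comm.append_right J)
  simpa [mul_assoc] using this

lemma monomial_deg {n : ℕ} (f : MvPolynomial (Fin n) ℂ) (s : Fin n →₀ ℕ) (hs : s ∈ f.support) :
    ((List.finRange n).map s).sum ≤ f.totalDegree := by
  have h := MvPolynomial.le_totalDegree hs
  rw [Finsupp.sum_fintype _ _ (by simp)] at h
  rwa [← List.ofFn_eq_map, List.sum_ofFn]

lemma evalSorted_mem {n d : ℕ} (M : Fin n → Matrix (Fin d) (Fin d) ℂ)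
    (f : MvPolynomial (Fin n) ℂ) : evalSorted M f ∈ wordSpan M f.totalDegree := by
  refine Submodule.sum_mem _ fun s hs => Submodule.smul_mem _ _ ?_
  rw [List.ofFn_eq_map]
  refine wordSpan_mono M (monomial_deg f s hs) (wordSpan_list M _ _ (fun i => ?_) _)
  have : M i ∈ wordSpan M 1 := Submodule.subset_span ⟨[i], by simp, by simp⟩
  simpa using wordSpan_pow M this (s i)

lemma evalSortedStar_mem {n d : ℕ} (M : Fin n → Matrix (Fin d) (Fin d) ℂ)
    (hstar : ∀ i, ∃ j, (M i)ᴴ = M j)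
    (f : MvPolynomial (Fin n) ℂ) :
    evalSortedStar (fun i => (M i)ᴴ) f ∈ wordSpan M f.totalDegree := by
  refine Submodule.sum_mem _ fun s hs => Submodule.smul_mem _ _ ?_
  rw [List.ofFn_eq_map, ← List.map_reverse]
  have hd := monomial_deg f s hs
  rw [← List.sum_reverse, ← List.map_reverse] at hd
  refine wordSpan_mono M hd (wordSpan_list M _ _ (fun i => ?_) _)
  obtain ⟨j, hj⟩ := hstar i
  have : (M i)ᴴ ∈ wordSpan M 1 := Submodule.subset_span ⟨[j], by simp, by simp [hj]⟩
  simpa using wordSpan_pow M this (s i)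

/-- **Lemma.** Let `f ∈ ℂ[X₁,…,Xₙ]`, `k ∈ ℕ`, let `ℳ` be a `∗`-closed tuple of `d×d`
complex matrices and let `x ∈ ℂ^d` be such that `ℳ` is `(2k·deg f)`-commutative at `x`. Then
`[f*(ℳ*)·f(ℳ)]^k (x) = [f*(ℳ*)]^k·[f(ℳ)]^k (x)`, where `ℳ* = (M₁ᴴ, …, Mₙᴴ)`. -/
theorem star_power_commute_at
    (n : ℕ) (hn : 0 < n) (d : ℕ) (f : MvPolynomial (Fin n) ℂ) (k : ℕ)
    (M : Fin n → Matrix (Fin d) (Fin d) ℂ)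
    (hstar : ∀ i, ∃ j, (M i)ᴴ = M j)
    (x : Fin d → ℂ)
    (hcomm : RCommAt M (2 * k * f.totalDegree) x) :
    ((evalSortedStar (fun i => (M i)ᴴ) f * evalSorted M f) ^ k).mulVec x =
      ((evalSortedStar (fun i => (M i)ᴴ) f) ^ k * (evalSorted M f) ^ k).mulVec x := by
  have hF := evalSorted_mem M f
  have hG := evalSortedStar_mem M hstar f
  generalize evalSorted M f = F at *
  generalize evalSortedStar (fun i => (M i)ᴴ) f = G at *
  generalize f.totalDegree = D at *
  suffices H : ∀ j ≤ k, ((G * F) ^ j).mulVec x = (G ^ j * F ^ j).mulVec x from H k le_rfl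
  intro j
  induction j with
  | zero => intro _; simp
  | succ j ih =>
    intro hj
    have hle : D + j * D + j * D ≤ 2 * k * D := by
      have : (2 * j + 1) * D ≤ 2 * k * D := Nat.mul_le_mul_right _ (by omega)
      linarith
    have hcm := wordSpan_comm hcomm hle hF (wordSpan_pow M hG j) (wordSpan_pow M hF j)
    calc ((G * F) ^ (j + 1)).mulVec x = (G * F).mulVec (((G * F) ^ j).mulVec x) := by
          rw [pow_succ', Matrix.mulVec_mulVec]
      _ = G.mulVec ((F * G ^ j * F ^ j).mulVec x) := by
          rw [ih (by omega)]; simp only [Matrix.mulVec_mulVec, mul_assoc]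
      _ = (G ^ (j + 1) * F ^ (j + 1)).mulVec x := by
          rw [hcm]; simp only [Matrix.mulVec_mulVec, pow_succ' G, pow_succ' F, mul_assoc]
end

section
/- Fix n ∈ ℕ₊. For every δ > 0 and every r ∈ ℕ there exists η > 0 such that for every d ∈ ℕ₊: if ℳ is an η-commuting ∗-closed tuple of d×d complex matrices, then there exists an r-multi-ballspace W ⊆ ℂ^d for ℳ such that dim(W) ≥ (1−δ)·d. -/
open MvPolynomial Module Matrix

variable {V : Type*} [AddCommGroup V] [Module ℂ V]

/-- For a tuple `M : Fin n → End(V)` and a word `α : [q] → [n]`, the composite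
`ℳ_α = M_{α 0} ∘ ⋯ ∘ M_{α (q-1)}` (the empty word gives the identity). -/
noncomputable def mword {n : ℕ} (M : Fin n → Module.End ℂ V) {q : ℕ}
    (α : Fin q → Fin n) : Module.End ℂ V :=
  (List.ofFn fun j => M (α j)).prod

/-- The `R`-ballspace `B_ℳ(w, R)`: the span of all `ℳ_α(w)` over words `α` of length `≤ R`. -/
noncomputable def ballSpace {n : ℕ} (M : Fin n → Module.End ℂ V) (w : V) (R : ℕ) :
    Submodule ℂ V :=
  Submodule.span ℂ {v | ∃ (q : ℕ) (_ : q ≤ R) (α : Fin q → Fin n), v = mword M α w}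

/-- `F^𝔞_i`: the subspace of `ℂ[X₁,…,Xₙ]/𝔞` of elements representable as `f + 𝔞` with
`deg f ≤ i`. -/
noncomputable def Fdeg (n : ℕ) (𝔞 : Ideal (MvPolynomial (Fin n) ℂ)) (i : ℕ) :
    Submodule ℂ (MvPolynomial (Fin n) ℂ ⧸ 𝔞) :=
  (restrictTotalDegree (Fin n) ℂ i).map (Ideal.Quotient.mkₐ ℂ 𝔞).toLinearMap

/-- `μ^𝔞ᵢ`: multiplication by `Xᵢ + 𝔞` on `ℂ[X₁,…,Xₙ]/𝔞`. -/
noncomputable def muX (n : ℕ) (𝔞 : Ideal (MvPolynomial (Fin n) ℂ)) (i : Fin n) :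
    Module.End ℂ (MvPolynomial (Fin n) ℂ ⧸ 𝔞) :=
  LinearMap.mulLeft ℂ (Ideal.Quotient.mk 𝔞 (X i))

/-- The ballspace `B_ℳ(w, R)` is regular. -/
noncomputable def IsRegularBall {n : ℕ} (M : Fin n → Module.End ℂ V) (w : V) (R : ℕ) : Prop :=
  ∃ (𝔞 : Ideal (MvPolynomial (Fin n) ℂ))
    (φ : (ballSpace M w R) ≃ₗ[ℂ] (Fdeg n 𝔞 R)),
    (∀ (j : ℕ), j + 1 = R → ∀ (i : Fin n) (v : V),
      v ∈ ballSpace M w j → ∀ (hv' : v ∈ ballSpace M w R) (hvi : M i v ∈ ballSpace M w R),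
        ((φ ⟨M i v, hvi⟩ : Fdeg n 𝔞 R) : MvPolynomial (Fin n) ℂ ⧸ 𝔞) =
          muX n 𝔞 i ((φ ⟨v, hv'⟩ : Fdeg n 𝔞 R) : MvPolynomial (Fin n) ℂ ⧸ 𝔞)) ∧
    (∀ x : MvPolynomial (Fin n) ℂ ⧸ 𝔞, x ∈ Fdeg n 𝔞 R →
      x ∈ Ideal.map (Ideal.Quotient.mk 𝔞) 𝔞.radical → x = 0)

/-- `W` is an `r`-multi-ballspace for `ℳ`: a direct sum of regular ballspaces
`B_ℳ(wⱼ, Rⱼ)` with roots `wⱼ ∈ W` and radii `Rⱼ ≥ r`. -/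
noncomputable def IsMultiBall {n : ℕ} (M : Fin n → Module.End ℂ V) (r : ℕ)
    (W : Submodule ℂ V) : Prop :=
  ∃ (k : ℕ) (w : Fin k → V) (Rad : Fin k → ℕ),
    (∀ j, r ≤ Rad j) ∧ (∀ j, w j ∈ W) ∧
    (∀ j, IsRegularBall M (w j) (Rad j)) ∧
    (W = ⨆ j, ballSpace M (w j) (Rad j)) ∧
    iSupIndep (fun j => ballSpace M (w j) (Rad j))

open Filter

abbrev HC := Germ ((hyperfilter ℕ : Ultrafilter ℕ) : Filter ℕ) ℂ

noncomputable def pig : (ℕ → ℂ) →+* HC := Germ.coeRingHom _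

lemma pig_surj : Function.Surjective pig := fun x => by
  induction x using Germ.inductionOn with
  | _ f => exact ⟨f, rfl⟩

lemma pig_zero (f : ℕ → ℂ) : pig f = 0 ↔ ∀ᶠ K in (hyperfilter ℕ : Filter ℕ), f K = 0 :=
  Germ.coe_eq

abbrev evk (K : ℕ) : (ℕ → ℂ) →+* ℂ := Pi.evalRingHom (fun _ : ℕ => ℂ) K

instance : IsAlgClosed HC := by
  apply IsAlgClosed.of_exists_root
  intro p hm hirr
  obtain ⟨P, rfl⟩ := Polynomial.map_surjective pig pig_surj p
  have hd := hirr.natDegree_pos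
  set m := (P.map pig).natDegree with hmdef
  have h1 : pig (P.coeff m) ≠ 0 := by
    have : (P.map pig).coeff m = 1 := hm
    rw [Polynomial.coeff_map] at this
    rw [this]; exact one_ne_zero
  have h2 : ∀ᶠ K in (hyperfilter ℕ : Filter ℕ), ¬ (P.coeff m K = 0) := by
    rw [Ultrafilter.eventually_not]
    rwa [Ne, pig_zero] at h1
  have h3 : ∀ K, ∃ x : ℂ, P.coeff m K ≠ 0 → (P.map (evk K)).eval x = 0 := by
    intro K
    by_cases h : P.coeff m K = 0
    · exact ⟨0, fun h' => absurd h h'⟩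
    · have : (P.map (evk K)).degree ≠ 0 := by
        intro h0
        have h4 := Polynomial.eq_C_of_degree_eq_zero h0
        have h5 : (P.map (evk K)).coeff m = P.coeff m K := by
          rw [Polynomial.coeff_map]; rfl
        rw [h4, Polynomial.coeff_C, if_neg hd.ne'] at h5
        exact h h5.symm
      obtain ⟨x, hx⟩ := IsAlgClosed.exists_root _ this
      exact ⟨x, fun _ => hx⟩
  choose x hx using h3
  refine ⟨pig x, ?_⟩
  rw [Polynomial.eval_map_apply, pig_zero]
  filter_upwards [h2] with K hK
  have := hx K hK
  have h6 := Polynomial.eval_map_apply (evk K) (p := P) x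
  rw [← this]
  exact h6.symm

lemma eval_pig {n : ℕ} (F : MvPolynomial (Fin n) (ℕ → ℂ)) (x : Fin n → ℕ → ℂ) :
    eval (fun i => pig (x i)) (MvPolynomial.map pig F)
      = pig (fun K => eval (fun i => x i K) (MvPolynomial.map (evk K) F)) := by
  have h0 := MvPolynomial.map_eval pig x F
  refine h0.symm.trans ?_
  congr 1
  funext K
  exact MvPolynomial.map_eval (evk K) x F

lemma totalDegree_map_le' {n : ℕ} {A B : Type*} [CommSemiring A] [CommSemiring B] (f : A →+* B)
    (F : MvPolynomial (Fin n) A) : (MvPolynomial.map f F).totalDegree ≤ F.totalDegree := by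
  have h : (MvPolynomial.map f F).support ⊆ F.support := support_map_subset f F
  exact Finset.sup_mono h

lemma map_pig_zero {n : ℕ} (F : MvPolynomial (Fin n) (ℕ → ℂ)) (h : MvPolynomial.map pig F = 0) :
    ∀ᶠ K in (hyperfilter ℕ : Filter ℕ), MvPolynomial.map (evk K) F = 0 := by
  have h1 : ∀ m ∈ F.support, ∀ᶠ K in (hyperfilter ℕ : Filter ℕ), F.coeff m K = 0 := by
    intro m _
    rw [← pig_zero, ← coeff_map, h, coeff_zero]
  rw [← Filter.eventually_all_finset] at h1
  filter_upwards [h1] with K hK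
  ext m
  rw [coeff_map, coeff_zero]
  by_cases hm : m ∈ F.support
  · exact hK m hm
  · rw [MvPolynomial.notMem_support_iff] at hm
    rw [hm, map_zero]

/-- ultraproduct ideal -/
def ultraIdeal {n : ℕ} (I : ℕ → Submodule ℂ (MvPolynomial (Fin n) ℂ))
    (ha : ∀ K, ∀ f ∈ I K, ∀ i, f.totalDegree + 1 ≤ K → X i * f ∈ I K) :
    Ideal (MvPolynomial (Fin n) HC) where
  carrier := {f | ∃ F, MvPolynomial.map pig F = f ∧
    ∀ᶠ K in (hyperfilter ℕ : Filter ℕ), MvPolynomial.map (evk K) F ∈ I K}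
  zero_mem' := ⟨0, by simp, by simp⟩
  add_mem' := by
    rintro _ _ ⟨F, rfl, hF⟩ ⟨G, rfl, hG⟩
    refine ⟨F + G, by simp, ?_⟩
    filter_upwards [hF, hG] with K h1 h2
    rw [map_add]
    exact add_mem h1 h2
  smul_mem' := by
    intro c
    induction c using MvPolynomial.induction_on with
    | C a =>
      rintro _ ⟨F, rfl, hF⟩
      obtain ⟨a, rfl⟩ := pig_surj a
      refine ⟨C a * F, by simp, ?_⟩
      filter_upwards [hF] with K h1
      rw [map_mul, map_C, ← smul_eq_C_mul]
      exact Submodule.smul_mem _ _ h1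
    | add p q hp hq =>
      intro x hx
      obtain ⟨F, h1, hF⟩ := hp hx
      obtain ⟨G, h2, hG⟩ := hq hx
      refine ⟨F + G, by simp [h1, h2, add_mul], ?_⟩
      filter_upwards [hF, hG] with K h1 h2
      rw [map_add]
      exact add_mem h1 h2
    | mul_X p i hp =>
      intro x hx
      obtain ⟨F, h1, hF⟩ := hp hx
      refine ⟨X i * F, by rw [map_mul, h1, map_X]; simp only [smul_eq_mul]; ring, ?_⟩
      have hK : ∀ᶠ K in (hyperfilter ℕ : Filter ℕ), F.totalDegree + 1 ≤ K :=
        Nat.hyperfilter_le_atTop (eventually_ge_atTop _)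
      filter_upwards [hF, hK] with K h1 h2
      rw [map_mul, map_X]
      exact ha K _ h1 i (le_trans (by gcongr; exact totalDegree_map_le' _ _) h2)

lemma mem_ultraIdeal {n : ℕ} (I : ℕ → Submodule ℂ (MvPolynomial (Fin n) ℂ))
    (ha : ∀ K, ∀ f ∈ I K, ∀ i, f.totalDegree + 1 ≤ K → X i * f ∈ I K)
    (F : MvPolynomial (Fin n) (ℕ → ℂ)) : MvPolynomial.map pig F ∈ ultraIdeal I ha ↔
      ∀ᶠ K in (hyperfilter ℕ : Filter ℕ), MvPolynomial.map (evk K) F ∈ I K := by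
  constructor
  · rintro ⟨G, h1, hG⟩
    have := map_pig_zero (F - G) (by rw [map_sub, h1, sub_self])
    filter_upwards [hG, this] with K h2 h3
    rw [map_sub, sub_eq_zero] at h3
    rwa [h3]
  · exact fun h => ⟨F, rfl, h⟩

lemma lift_seq {n : ℕ} (R : ℕ) (f : ℕ → MvPolynomial (Fin n) ℂ) (hf : ∀ K, (f K).totalDegree ≤ R) :
    ∃ F : MvPolynomial (Fin n) (ℕ → ℂ), ∀ K, MvPolynomial.map (evk K) F = f K := by
  have hfin : {m : Fin n →₀ ℕ | m.degree ≤ R}.Finite := Finsupp.finite_of_degree_le R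
  refine ⟨∑ m ∈ hfin.toFinset, monomial m (fun K => (f K).coeff m), fun K => ?_⟩
  rw [map_sum]
  simp only [map_monomial]
  ext m
  rw [coeff_sum]
  simp only [coeff_monomial]
  rw [Finset.sum_ite_eq' hfin.toFinset m]
  split_ifs with h
  · rfl
  · symm
    by_contra h0
    apply h
    have h1 := le_totalDegree (mem_support_iff.2 h0)
    simp only [Set.Finite.mem_toFinset, Set.mem_ofPred_eq]
    exact le_trans h1 (hf K)

/-- Regularity -/
lemma reg_exists (n R : ℕ) : ∃ K : ℕ, ∀ I : Submodule ℂ (MvPolynomial (Fin n) ℂ),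
    (∀ f ∈ I, ∀ i, f.totalDegree + 1 ≤ K → X i * f ∈ I) →
    (∀ f, f ^ 2 ∈ I → 4 * f.totalDegree ≤ K → f ∈ I) →
    ∃ S : Set (Fin n → ℂ), ∀ f : MvPolynomial (Fin n) ℂ, f.totalDegree ≤ R →
      (f ∈ I ↔ ∀ x ∈ S, eval x f = 0) := by
  by_contra hcon
  push Not at hcon
  choose I ha hb hc using hcon
  have hc' := fun K => hc K {x | ∀ f ∈ I K, f.totalDegree ≤ R → eval x f = 0}
  have hc2 : ∀ K, ∃ f : MvPolynomial (Fin n) ℂ, f.totalDegree ≤ R ∧ f ∉ I K ∧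
      ∀ x, (∀ f ∈ I K, f.totalDegree ≤ R → eval x f = 0) → eval x f = 0 := by
    intro K
    obtain ⟨f, hf, h⟩ := hc' K
    rcases h with ⟨h1, x, hx, h2⟩ | ⟨h1, h2⟩
    · exact absurd (hx f h1 hf) h2
    · exact ⟨f, hf, h1, h2⟩
  choose f hfd hfI hfv using hc2
  obtain ⟨F, hF⟩ := lift_seq R f hfd
  have hrad : (ultraIdeal I ha).IsRadical := by
    rw [Ideal.isRadical_iff_pow_one_lt 2 (by norm_num)]
    intro g hg
    obtain ⟨G, rfl⟩ := MvPolynomial.map_surjective pig pig_surj g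
    rw [← map_pow, mem_ultraIdeal] at hg
    rw [mem_ultraIdeal]
    have hK : ∀ᶠ K in (hyperfilter ℕ : Filter ℕ), 4 * G.totalDegree ≤ K :=
      Nat.hyperfilter_le_atTop (eventually_ge_atTop _)
    filter_upwards [hg, hK] with K h1 h2
    rw [map_pow] at h1
    exact hb K _ h1 (le_trans (by gcongr; exact totalDegree_map_le' _ _) h2)
  have hFn : MvPolynomial.map pig F ∉ ultraIdeal I ha := by
    rw [mem_ultraIdeal, ← Ultrafilter.eventually_not]
    exact Eventually.of_forall fun K => by rw [hF]; exact hfI K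
  rw [← hrad.radical, ← vanishingIdeal_zeroLocus_eq_radical (K := HC), mem_vanishingIdeal_iff] at hFn
  push Not at hFn
  obtain ⟨x, hx, hne⟩ := hFn
  choose y hy using fun i => pig_surj (x i)
  obtain rfl : (fun i => pig (y i)) = x := funext hy
  have h1 : ∀ᶠ K in (hyperfilter ℕ : Filter ℕ), ¬ (eval (fun i => y i K) (f K) = 0) := by
    rw [Ultrafilter.eventually_not, ]
    intro h
    apply hne
    rw [aeval_eq_eval, eval_pig, pig_zero]
    simpa only [hF] using h
  have h2 : ∀ K, ∃ g : MvPolynomial (Fin n) ℂ, g.totalDegree ≤ R ∧ g ∈ I K ∧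
      (¬ (eval (fun i => y i K) (f K) = 0) → eval (fun i => y i K) g ≠ 0) := by
    intro K
    by_cases h : eval (fun i => y i K) (f K) = 0
    · exact ⟨0, by simp, by simp, fun h' => absurd h h'⟩
    · have := mt (hfv K (fun i => y i K)) h
      push Not at this
      obtain ⟨g, h1, h2, h3⟩ := this
      exact ⟨g, h2, h1, fun _ => h3⟩
  choose g hgd hgI hgv using h2
  obtain ⟨G, hG⟩ := lift_seq R g hgd
  have hGI : MvPolynomial.map pig G ∈ ultraIdeal I ha := by
    rw [mem_ultraIdeal]
    exact Eventually.of_forall fun K => by rw [hG]; exact hgI K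
  have h3 := hx _ hGI
  rw [aeval_eq_eval, eval_pig, pig_zero] at h3
  have h4 : ∀ᶠ K in (hyperfilter ℕ : Filter ℕ), False := by
    filter_upwards [h1, h3] with K h5 h6
    rw [hG] at h6
    exact hgv K h5 h6
  exact h4.exists.choose_spec

section partTwo

variable {n : ℕ}

noncomputable def wl (M : Fin n → Module.End ℂ V) (l : List (Fin n)) : Module.End ℂ V :=
  (l.map M).prod

lemma wl_nil (M : Fin n → Module.End ℂ V) (w : V) : wl M [] w = w := by simp [wl]

lemma wl_cons (M : Fin n → Module.End ℂ V) (i : Fin n) (l : List (Fin n)) (w : V) :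
    wl M (i :: l) w = M i (wl M l w) := by simp [wl]

lemma wl_append (M : Fin n → Module.End ℂ V) (l l' : List (Fin n)) (w : V) :
    wl M (l ++ l') w = wl M l (wl M l' w) := by simp [wl]

lemma ballSpace_eq (M : Fin n → Module.End ℂ V) (w : V) (R : ℕ) :
    ballSpace M w R = Submodule.span ℂ {v | ∃ l : List (Fin n), l.length ≤ R ∧ wl M l w = v} := by
  unfold ballSpace
  congr 1
  ext v
  constructor
  · rintro ⟨q, hq, α, rfl⟩
    refine ⟨List.ofFn α, by simpa using hq, ?_⟩
    rw [wl, mword, List.map_ofFn]; rfl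
  · rintro ⟨l, hl, rfl⟩
    refine ⟨l.length, hl, l.get, ?_⟩
    rw [wl, mword]
    congr 2
    conv_lhs => rw [← List.ofFn_get l]
    rw [List.map_ofFn]; rfl

lemma wl_mem_ball (M : Fin n → Module.End ℂ V) (w : V) {R : ℕ} {l : List (Fin n)}
    (hl : l.length ≤ R) : wl M l w ∈ ballSpace M w R := by
  rw [ballSpace_eq]; exact Submodule.subset_span ⟨l, hl, rfl⟩

lemma self_mem_ball (M : Fin n → Module.End ℂ V) (w : V) (R : ℕ) : w ∈ ballSpace M w R := by
  have := wl_mem_ball M w (R := R) (l := []) (by simp)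
  rwa [wl_nil] at this

lemma ball_mono (M : Fin n → Module.End ℂ V) (w : V) {R R' : ℕ} (h : R ≤ R') :
    ballSpace M w R ≤ ballSpace M w R' := by
  rw [ballSpace_eq, ballSpace_eq]
  exact Submodule.span_mono fun v ⟨l, hl, hv⟩ => ⟨l, hl.trans h, hv⟩

lemma wl_ball (M : Fin n → Module.End ℂ V) (w : V) {R : ℕ} (l : List (Fin n)) {z : V}
    (hz : z ∈ ballSpace M w R) : wl M l z ∈ ballSpace M w (R + l.length) := by
  rw [ballSpace_eq] at hz
  induction hz using Submodule.span_induction with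
  | mem x h =>
    obtain ⟨l', h1, rfl⟩ := h
    rw [← wl_append]
    exact wl_mem_ball _ _ (by rw [List.length_append]; omega)
  | zero => simp
  | add x y _ _ hx hy => rw [map_add]; exact add_mem hx hy
  | smul a x _ hx => rw [map_smul]; exact Submodule.smul_mem _ _ hx

/-- commutation up to word length K at w -/
def CommAt (M : Fin n → Module.End ℂ V) (w : V) (K : ℕ) : Prop :=
  ∀ l : List (Fin n), l.length ≤ K → ∀ i j, M i (M j (wl M l w)) = M j (M i (wl M l w))

lemma CommAt.perm {M : Fin n → Module.End ℂ V} {w : V} {K : ℕ} (h : CommAt M w K)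
    {l l' : List (Fin n)} (hp : l.Perm l') : l.length ≤ K → wl M l w = wl M l' w := by
  induction hp with
  | nil => intro _; rfl
  | cons x _ ih =>
    intro hl
    rw [wl_cons, wl_cons, ih (by simp at hl; omega)]
  | swap x y l =>
    intro hl
    simp only [wl_cons]
    exact h _ (by simp at hl; omega) _ _
  | trans h1 h2 ih1 ih2 =>
    intro hl
    rw [ih1 hl, ih2 (by rwa [← h1.length_eq])]

noncomputable def Tw (M : Fin n → Module.End ℂ V) (w : V) : MvPolynomial (Fin n) ℂ →ₗ[ℂ] V :=
  (basisMonomials (Fin n) ℂ).constr ℂ (fun m => wl M (Finsupp.toMultiset m).toList w)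

lemma list_prod_X (l : List (Fin n)) : (l.map (X : Fin n → MvPolynomial (Fin n) ℂ)).prod =
    monomial (Multiset.toFinsupp (l : Multiset (Fin n))) 1 := by
  induction l with
  | nil => simp
  | cons i l ih =>
    rw [List.map_cons, List.prod_cons, ih, X, monomial_mul, ← Multiset.cons_coe,
      ← Multiset.singleton_add, map_add, Multiset.toFinsupp_singleton, one_mul]

lemma Tw_list {M : Fin n → Module.End ℂ V} {w : V} {K : ℕ} (h : CommAt M w K)
    {l : List (Fin n)} (hl : l.length ≤ K) : Tw M w (l.map X).prod = wl M l w := by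
  rw [list_prod_X]
  have : (monomial (Multiset.toFinsupp (l : Multiset (Fin n))) (1 : ℂ)) =
    basisMonomials (Fin n) ℂ (Multiset.toFinsupp (l : Multiset (Fin n))) := by simp
  rw [this, Tw, Basis.constr_basis, Multiset.toFinsupp_toMultiset]
  symm
  apply h.perm _ hl
  rw [← Multiset.coe_eq_coe, Multiset.coe_toList]

lemma rtd_span (R : ℕ) : restrictTotalDegree (Fin n) ℂ R =
    Submodule.span ℂ {p | ∃ l : List (Fin n), l.length ≤ R ∧ (l.map X).prod = p} := by
  apply le_antisymm
  · intro p hp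
    rw [mem_restrictTotalDegree] at hp
    rw [← support_sum_monomial_coeff p]
    apply Submodule.sum_mem
    intro m hm
    have : monomial m (coeff m p) = coeff m p • monomial m (1 : ℂ) := by
      rw [smul_monomial, smul_eq_mul, mul_one]
    rw [this]
    apply Submodule.smul_mem
    apply Submodule.subset_span
    refine ⟨(Finsupp.toMultiset m).toList, ?_, ?_⟩
    · rw [Multiset.length_toList, Finsupp.card_toMultiset]
      exact (le_totalDegree hm).trans hp
    · rw [list_prod_X, Multiset.coe_toList, Finsupp.toMultiset_toFinsupp]
  · rw [Submodule.span_le]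
    rintro _ ⟨l, hl, rfl⟩
    rw [SetLike.mem_coe, mem_restrictTotalDegree]
    refine (totalDegree_list_prod _).trans ?_
    rw [List.map_map]
    refine le_trans (List.sum_le_card_nsmul _ 1 ?_) (by simpa using hl)
    simp

lemma mem_rtd_induction {R : ℕ} {P : MvPolynomial (Fin n) ℂ → Prop}
    (h1 : ∀ l : List (Fin n), l.length ≤ R → P (l.map X).prod) (h0 : P 0)
    (ha : ∀ p q, P p → P q → P (p + q)) (hs : ∀ (c : ℂ) p, P p → P (c • p))
    (p : MvPolynomial (Fin n) ℂ) (hp : p.totalDegree ≤ R) : P p := by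
  rw [← mem_restrictTotalDegree, rtd_span] at hp
  induction hp using Submodule.span_induction with
  | mem x h => obtain ⟨l, hl, rfl⟩ := h; exact h1 l hl
  | zero => exact h0
  | add x y _ _ hx hy => exact ha _ _ hx hy
  | smul a x _ hx => exact hs _ _ hx

lemma ball_eq_map {M : Fin n → Module.End ℂ V} {w : V} {K : ℕ} (h : CommAt M w K) {R : ℕ}
    (hR : R ≤ K) : ballSpace M w R = (restrictTotalDegree (Fin n) ℂ R).map (Tw M w) := by
  rw [rtd_span, Submodule.map_span, ballSpace_eq]
  congr 1
  ext v
  constructor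
  · rintro ⟨l, hl, rfl⟩
    exact ⟨_, ⟨l, hl, rfl⟩, Tw_list h (hl.trans hR)⟩
  · rintro ⟨_, ⟨l, hl, rfl⟩, rfl⟩
    exact ⟨l, hl, (Tw_list h (hl.trans hR)).symm⟩

lemma Tw_X_mul {M : Fin n → Module.End ℂ V} {w : V} {K : ℕ} (h : CommAt M w K) (i : Fin n)
    {R : ℕ} (hR : R + 1 ≤ K) (p : MvPolynomial (Fin n) ℂ) (hp : p.totalDegree ≤ R) :
    Tw M w (X i * p) = M i (Tw M w p) := by
  refine mem_rtd_induction (R := R) (P := fun p => Tw M w (X i * p) = M i (Tw M w p))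
    ?_ ?_ ?_ ?_ p hp
  · intro l hl
    rw [Tw_list h (by omega), ← wl_cons, ← Tw_list h (by simp; omega)]
    simp
  · simp
  · intro p q hp hq
    rw [mul_add, map_add, map_add, map_add, hp, hq]
  · intro c p hp
    rw [mul_smul_comm, map_smul, map_smul, map_smul, hp]

lemma Tw_mul_zero {M : Fin n → Module.End ℂ V} {w : V} {K : ℕ} (h : CommAt M w K)
    {a b : ℕ} (hab : a + b ≤ K) (p : MvPolynomial (Fin n) ℂ) (hp : p.totalDegree ≤ a)
    (q : MvPolynomial (Fin n) ℂ) (hq : q.totalDegree ≤ b) (h0 : Tw M w q = 0) :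
    Tw M w (p * q) = 0 := by
  refine mem_rtd_induction (R := a) (P := fun p => Tw M w (p * q) = 0) ?_ ?_ ?_ ?_ p hp
  · intro l hl
    have : Tw M w ((l.map X).prod * q) = wl M l (Tw M w q) := by
      induction l with
      | nil => simp [wl_nil]
      | cons i l ih =>
        simp only [List.length_cons] at hl
        rw [List.map_cons, List.prod_cons, mul_assoc, wl_cons, ← ih (by omega)]
        apply Tw_X_mul h i (R := l.length + b) (by omega)
        refine (totalDegree_mul _ _).trans (add_le_add ?_ hq)
        rw [← mem_restrictTotalDegree, rtd_span]
        exact Submodule.subset_span ⟨l, le_rfl, rfl⟩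
    rw [this, h0, map_zero]
  · simp
  · intro p q hp hq
    rw [add_mul, map_add, hp, hq, add_zero]
  · intro c p hp
    rw [smul_mul_assoc, map_smul, hp, smul_zero]

lemma totalDegree_list (l : List (Fin n)) :
    ((l.map X).prod : MvPolynomial (Fin n) ℂ).totalDegree ≤ l.length := by
  rw [← mem_restrictTotalDegree, rtd_span]
  exact Submodule.subset_span ⟨l, le_rfl, rfl⟩

lemma finrank_ball_le {M : Fin n → Module.End ℂ V} {w : V} {K : ℕ} (h : CommAt M w K) {R : ℕ}
    (hR : R ≤ K) : finrank ℂ (ballSpace M w R) ≤ (R + 1) ^ n := by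
  have h1 : ballSpace M w R ≤ Submodule.span ℂ (Set.range
      (fun m : Fin n → Fin (R + 1) =>
        Tw M w (monomial (Finsupp.equivFunOnFinite.symm fun i => (m i : ℕ)) 1))) := by
    rw [ball_eq_map h hR, Submodule.map_le_iff_le_comap, rtd_span, Submodule.span_le]
    rintro _ ⟨l, hl, rfl⟩
    rw [SetLike.mem_coe, Submodule.mem_comap, list_prod_X]
    apply Submodule.subset_span
    have hc : ∀ i, l.count i < R + 1 := fun i => by
      have := List.count_le_length (a := i) (l := l); omega
    have he : (Finsupp.equivFunOnFinite.symm fun i => l.count i) =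
        Multiset.toFinsupp (l : Multiset (Fin n)) := by
      ext i; simp
    refine ⟨fun i => ⟨l.count i, hc i⟩, ?_⟩
    rw [← he]
  have := FiniteDimensional.span_of_finite ℂ (Set.finite_range
      (fun m : Fin n → Fin (R + 1) =>
        Tw M w (monomial (Finsupp.equivFunOnFinite.symm fun i => (m i : ℕ)) 1)))
  have h2 := Submodule.finrank_mono h1
  refine h2.trans ((finrank_range_le_card _).trans ?_)
  simp

lemma exists_equiv_range {E A A' : Type*} [AddCommGroup E] [Module ℂ E] [AddCommGroup A] [Module ℂ A]
    [AddCommGroup A'] [Module ℂ A'] (P : Submodule ℂ E) (f : E →ₗ[ℂ] A) (g : E →ₗ[ℂ] A')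
    (hfg : ∀ x ∈ P, f x = 0 ↔ g x = 0) :
    ∃ e : P.map f ≃ₗ[ℂ] P.map g, ∀ x (_ : x ∈ P) (h : f x ∈ P.map f), (e ⟨f x, h⟩ : A') = g x := by
  have hk : LinearMap.ker (f.domRestrict P) = LinearMap.ker (g.domRestrict P) := by
    ext ⟨x, hx⟩
    simpa using hfg x hx
  have hf : LinearMap.range (f.domRestrict P) = P.map f := by
    rw [LinearMap.range_domRestrict]
  have hg : LinearMap.range (g.domRestrict P) = P.map g := by
    rw [LinearMap.range_domRestrict]
  refine ⟨(LinearEquiv.ofEq _ _ hf).symm ≪≫ₗ (LinearMap.quotKerEquivRange _).symm ≪≫ₗ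
    Submodule.quotEquivOfEq _ _ hk ≪≫ₗ LinearMap.quotKerEquivRange _ ≪≫ₗ LinearEquiv.ofEq _ _ hg, ?_⟩
  intro x hx h
  have : (LinearMap.quotKerEquivRange (f.domRestrict P)).symm ((LinearEquiv.ofEq _ _ hf).symm ⟨f x, h⟩)
      = Submodule.Quotient.mk ⟨x, hx⟩ := by
    rw [LinearEquiv.symm_apply_eq]
    ext
    simp
  simp only [LinearEquiv.trans_apply, this]
  simp

lemma regular_of_set {M : Fin n → Module.End ℂ V} {w : V} {K : ℕ} (h : CommAt M w K) {R : ℕ}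
    (hR : R ≤ K) (S : Set (Fin n → ℂ))
    (hS : ∀ f : MvPolynomial (Fin n) ℂ, f.totalDegree ≤ R →
      (Tw M w f = 0 ↔ ∀ x ∈ S, eval x f = 0)) : IsRegularBall M w R := by
  have hker : ∀ f ∈ restrictTotalDegree (Fin n) ℂ R, Tw M w f = 0 ↔
      (Ideal.Quotient.mkₐ ℂ (vanishingIdeal ℂ S)).toLinearMap f = 0 := by
    intro f hf
    rw [hS f (by rwa [mem_restrictTotalDegree] at hf)]
    simp only [AlgHom.toLinearMap_apply, Ideal.Quotient.mkₐ_eq_mk, Ideal.Quotient.eq_zero_iff_mem,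
      mem_vanishingIdeal_iff, aeval_eq_eval]
  obtain ⟨e, he⟩ := exists_equiv_range _ _ _ hker
  refine ⟨vanishingIdeal ℂ S, (LinearEquiv.ofEq _ _ (ball_eq_map h hR)) ≪≫ₗ e, ?_, ?_⟩
  · rintro j rfl i v hv hv' hvi
    rw [ball_eq_map h (by omega)] at hv
    obtain ⟨p, hp, rfl⟩ := hv
    rw [SetLike.mem_coe, mem_restrictTotalDegree] at hp
    have e1 := he p (by rw [mem_restrictTotalDegree]; omega) (by rwa [← ball_eq_map h hR])
    have hd : (X i * p).totalDegree ≤ j + 1 := by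
      refine (totalDegree_mul _ _).trans ?_
      rw [totalDegree_X]; omega
    have e2 := he (X i * p) (by rwa [mem_restrictTotalDegree])
      (by rw [Tw_X_mul h i hR p hp, ← ball_eq_map h hR]; exact hvi)
    simp only [Tw_X_mul h i hR p hp] at e2
    refine e2.trans ?_
    refine Eq.trans ?_ (congrArg (muX n (vanishingIdeal ℂ S) i) e1.symm)
    simp [muX]
  · intro x _ hx
    have hrad : (vanishingIdeal ℂ S).radical = vanishingIdeal ℂ S := by
      apply Ideal.IsRadical.radical
      rintro f ⟨m, hm⟩ x hx
      have := hm x hx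
      rw [map_pow] at this
      exact eq_zero_of_pow_eq_zero this
    rw [hrad, Ideal.map_quotient_self] at hx
    simpa using hx

end partTwo

section partThree

variable {n : ℕ}

/-- positive form with adjoints -/
structure AdjForm (M : Fin n → Module.End ℂ V) (B : V →ₗ⋆[ℂ] V →ₗ[ℂ] ℂ) (σ : Fin n → Fin n) :
    Prop where
  pos : ∀ x, B x x = 0 → x = 0
  symm : ∀ x y, B x y = 0 → B y x = 0
  adj : ∀ i x y, B (M i x) y = B x (M (σ i) y)
  adj' : ∀ i x y, B x (M i y) = B (M (σ i) x) y

variable {M : Fin n → Module.End ℂ V} {B : V →ₗ⋆[ℂ] V →ₗ[ℂ] ℂ} {σ : Fin n → Fin n}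

noncomputable def fst' (σ : Fin n → Fin n) (f : MvPolynomial (Fin n) ℂ) : MvPolynomial (Fin n) ℂ :=
  rename σ (MvPolynomial.map (starRingEnd ℂ) f)

lemma fst_deg (σ : Fin n → Fin n) (f : MvPolynomial (Fin n) ℂ) :
    (fst' σ f).totalDegree ≤ f.totalDegree :=
  (totalDegree_rename_le _ _).trans (totalDegree_map_le' _ _)

lemma fst_list (σ : Fin n → Fin n) (l : List (Fin n)) :
    fst' σ (l.map X).prod = ((l.map σ).map X).prod := by
  simp only [fst', map_list_prod, List.map_map]
  congr 1
  apply List.map_congr_left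
  intro i _
  simp

lemma adj_list (hB : AdjForm M B σ) {w : V} {K : ℕ} (h : CommAt M w K) {b : ℕ}
    (l : List (Fin n)) : ∀ {c : ℕ}, l.length + b ≤ K → l.length + c ≤ K →
    ∀ (g k : MvPolynomial (Fin n) ℂ), g.totalDegree ≤ b → k.totalDegree ≤ c →
    B (Tw M w ((l.map X).prod * g)) (Tw M w k) =
      B (Tw M w g) (Tw M w (((l.map σ).map X).prod * k)) := by
  induction l with
  | nil => intro c _ _ g k _ _; simp
  | cons i l ih =>
    intro c hb hc g k hg hk
    simp only [List.length_cons] at hb hc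
    simp only [List.map_cons, List.prod_cons]
    rw [mul_assoc, Tw_X_mul h i (R := l.length + b) (by omega) _
      ((totalDegree_mul _ _).trans (add_le_add (totalDegree_list l) hg)), hB.adj,
      ← Tw_X_mul h (σ i) (R := c) (by omega) _ hk]
    have hd : (X (σ i) * k).totalDegree ≤ c + 1 := by
      refine (totalDegree_mul _ _).trans ?_
      rw [totalDegree_X]; omega
    rw [ih (c := c + 1) (by omega) (by omega) _ _ hg hd]
    congr 2; ring

lemma adj_identity (hB : AdjForm M B σ) {w : V} {K : ℕ} (h : CommAt M w K) {a b c : ℕ}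
    (hab : a + b ≤ K) (hac : a + c ≤ K) (f g k : MvPolynomial (Fin n) ℂ)
    (hf : f.totalDegree ≤ a) (hg : g.totalDegree ≤ b) (hk : k.totalDegree ≤ c) :
    B (Tw M w (f * g)) (Tw M w k) = B (Tw M w g) (Tw M w (fst' σ f * k)) := by
  refine mem_rtd_induction (R := a) (P := fun f =>
    B (Tw M w (f * g)) (Tw M w k) = B (Tw M w g) (Tw M w (fst' σ f * k))) ?_ ?_ ?_ ?_ f hf
  · intro l hl
    rw [fst_list]
    exact adj_list hB h l (by omega) (by omega) g k hg hk
  · simp [fst']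
  · intro p q hp hq
    have : fst' σ (p + q) = fst' σ p + fst' σ q := by simp [fst']
    rw [this, add_mul, add_mul, map_add, map_add, map_add, map_add, LinearMap.add_apply, hp, hq]
  · intro z p hp
    have : fst' σ (z • p) = (starRingEnd ℂ) z • fst' σ p := by
      simp [fst', smul_eq_C_mul]
    rw [this, smul_mul_assoc, smul_mul_assoc, (Tw M w).map_smul, (Tw M w).map_smul,
      LinearMap.map_smulₛₗ, LinearMap.smul_apply, hp, (B (Tw M w g)).map_smul]

lemma ker_radical (hB : AdjForm M B σ) {w : V} {K : ℕ} (h : CommAt M w K)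
    (f : MvPolynomial (Fin n) ℂ) (hf : 4 * f.totalDegree ≤ K) (h2 : Tw M w (f ^ 2) = 0) :
    Tw M w f = 0 := by
  set a := f.totalDegree with ha
  have hs : (fst' σ f).totalDegree ≤ a := fst_deg σ f
  have hsf : (fst' σ f * f).totalDegree ≤ a + a :=
    (totalDegree_mul _ _).trans (add_le_add hs le_rfl)
  have h3 : Tw M w (fst' σ f * f ^ 2) = 0 := by
    apply Tw_mul_zero h (a := a) (b := 2 * a) (by omega) _ hs _ _ h2
    exact totalDegree_pow _ _
  have h4 : Tw M w (fst' σ f * f) = 0 := by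
    apply hB.pos
    rw [← adj_identity hB h (a := a) (b := a + a) (c := a) (by omega) (by omega) f _ f le_rfl hsf
      le_rfl]
    have : f * (fst' σ f * f) = fst' σ f * f ^ 2 := by ring
    rw [this, h3]; simp
  apply hB.pos
  have := adj_identity hB h (a := a) (b := 0) (c := a) (by omega) (by omega) f 1 f le_rfl (by simp)
    le_rfl
  rw [mul_one, h4, map_zero] at this
  exact this

lemma regular_exists (n b : ℕ) : ∃ K : ℕ, b ≤ K ∧ ∀ {V : Type} [AddCommGroup V] [Module ℂ V]
    (M : Fin n → Module.End ℂ V) (B : V →ₗ⋆[ℂ] V →ₗ[ℂ] ℂ) (σ : Fin n → Fin n), AdjForm M B σ →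
    ∀ w, CommAt M w K → ∀ R ≤ b, IsRegularBall M w R := by
  obtain ⟨K, hK⟩ := reg_exists n b
  refine ⟨max K b, le_max_right _ _, ?_⟩
  intro V _ _ M B σ hB w h R hR
  obtain ⟨S, hS⟩ := hK (LinearMap.ker (Tw M w)) (by
    intro f hf i hi
    rw [LinearMap.mem_ker] at hf ⊢
    rw [Tw_X_mul h i (hi.trans (le_max_left _ _)) f le_rfl, hf, map_zero]) (by
    intro f hf hi
    rw [LinearMap.mem_ker] at hf ⊢
    exact ker_radical hB h f (hi.trans (le_max_left _ _)) hf)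
  exact regular_of_set h (hR.trans (le_max_right _ _)) S fun f hf => hS f (hf.trans hR)

def OrthS (B : V →ₗ⋆[ℂ] V →ₗ[ℂ] ℂ) (A C : Submodule ℂ V) : Prop := ∀ x ∈ A, ∀ y ∈ C, B x y = 0

lemma adj_wl (hB : AdjForm M B σ) (l : List (Fin n)) : ∀ x y,
    B x (wl M l y) = B (wl M (l.map σ).reverse x) y := by
  induction l with
  | nil => intro x y; simp [wl_nil]
  | cons i l ih =>
    intro x y
    rw [wl_cons, hB.adj', ih, List.map_cons, List.reverse_cons, wl_append, wl_cons, wl_nil]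

lemma ball_orth (hB : AdjForm M B σ) {v w : V} {R R' : ℕ}
    (h : ∀ z ∈ ballSpace M v (R + R'), B z w = 0) :
    OrthS B (ballSpace M v R) (ballSpace M w R') := by
  intro x hx y hy
  rw [ballSpace_eq] at hy
  induction hy using Submodule.span_induction with
  | mem y hy =>
    obtain ⟨l, hl, rfl⟩ := hy
    rw [adj_wl hB]
    apply h
    refine ball_mono _ _ ?_ (wl_ball M v _ hx)
    simpa using hl
  | zero => simp
  | add y z _ _ h1 h2 => rw [map_add, h1, h2, add_zero]
  | smul c y _ h1 => rw [map_smul, h1, smul_zero]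

/-- sup of the list of balls -/
noncomputable def lsup (M : Fin n → Module.End ℂ V) : List (V × ℕ) → Submodule ℂ V
  | [] => ⊥
  | a :: L => ballSpace M a.1 a.2 ⊔ lsup M L

/-- dimension sum, with radii changed by e -/
noncomputable def dsum (M : Fin n → Module.End ℂ V) (e : ℕ → ℕ) : List (V × ℕ) → ℕ
  | [] => 0
  | a :: L => finrank ℂ (ballSpace M a.1 (e a.2)) + dsum M e L

def POrth (M : Fin n → Module.End ℂ V) (B : V →ₗ⋆[ℂ] V →ₗ[ℂ] ℂ) (L : List (V × ℕ)) : Prop :=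
  L.Pairwise fun a b => OrthS B (ballSpace M a.1 a.2) (ballSpace M b.1 b.2)

lemma OrthS.symm (hB : AdjForm M B σ) {A C : Submodule ℂ V} (h : OrthS B A C) : OrthS B C A :=
  fun x hx y hy => hB.symm _ _ (h y hy x hx)

lemma OrthS.disjoint (hB : AdjForm M B σ) {A C : Submodule ℂ V} (h : OrthS B A C) :
    Disjoint A C := by
  rw [Submodule.disjoint_def]
  intro x h1 h2
  exact hB.pos x (h x h1 x h2)

lemma OrthS.sup {A C D : Submodule ℂ V} (h : OrthS B A C) (h' : OrthS B A D) :
    OrthS B A (C ⊔ D) := by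
  intro x hx y hy
  obtain ⟨y1, h1, y2, h2, rfl⟩ := Submodule.mem_sup.1 hy
  rw [map_add, h x hx _ h1, h' x hx _ h2, add_zero]

lemma OrthS.iSup {ι : Sort*} {A : Submodule ℂ V} {C : ι → Submodule ℂ V}
    (h : ∀ i, OrthS B A (C i)) : OrthS B A (⨆ i, C i) := by
  intro x hx y hy
  have : (⨆ i, C i) ≤ LinearMap.ker (B x) := iSup_le fun i z hz => by
    rw [LinearMap.mem_ker]; exact h i x hx z hz
  exact this hy

lemma orth_lsup {A : Submodule ℂ V} (L : List (V × ℕ))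
    (h : ∀ a ∈ L, OrthS B A (ballSpace M a.1 a.2)) : OrthS B A (lsup M L) := by
  induction L with
  | nil => intro x _ y hy; rw [(Submodule.mem_bot ℂ).1 hy, map_zero]
  | cons a L ih =>
    exact OrthS.sup (h a (by simp)) (ih fun b hb => h b (by simp [hb]))

lemma dsum_eq [FiniteDimensional ℂ V] (hB : AdjForm M B σ) (L : List (V × ℕ)) (h : POrth M B L) :
    finrank ℂ (lsup M L) = dsum M id L := by
  induction L with
  | nil => exact finrank_bot ℂ V
  | cons a L ih =>
    rw [POrth, List.pairwise_cons] at h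
    have hd := (orth_lsup L h.1).disjoint hB
    have := Submodule.finrank_sup_add_finrank_inf_eq (ballSpace M a.1 a.2) (lsup M L)
    rw [hd.eq_bot, finrank_bot, ih h.2] at this
    rw [add_zero] at this
    exact this

lemma lsup_eq (L : List (V × ℕ)) :
    lsup M L = ⨆ j : Fin L.length, ballSpace M (L.get j).1 (L.get j).2 := by
  induction L with
  | nil => exact (iSup_eq_bot.2 (fun j : Fin 0 => j.elim0)).symm
  | cons a L ih =>
    apply le_antisymm
    · rw [lsup, ih]
      refine sup_le ?_ (iSup_le fun j => ?_)
      · exact le_iSup (fun j : Fin (a :: L).length =>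
          ballSpace M ((a :: L).get j).1 ((a :: L).get j).2) 0
      · exact le_iSup (fun j : Fin (a :: L).length =>
          ballSpace M ((a :: L).get j).1 ((a :: L).get j).2) j.succ
    · refine iSup_le fun j => ?_
      rw [lsup, ih]
      refine Fin.cases ?_ (fun j => ?_) j
      · exact le_sup_left
      · exact le_sup_of_le_right (le_iSup (fun j : Fin L.length =>
          ballSpace M (L.get j).1 (L.get j).2) j)

lemma isMultiBall_of_list (hB : AdjForm M B σ) (r : ℕ) (L : List (V × ℕ)) (h : POrth M B L)
    (hL : ∀ a ∈ L, r ≤ a.2 ∧ IsRegularBall M a.1 a.2) : IsMultiBall M r (lsup M L) := by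
  refine ⟨L.length, fun j => (L.get j).1, fun j => (L.get j).2, fun j => (hL _ (L.get_mem j)).1,
    fun j => ?_, fun j => (hL _ (L.get_mem j)).2, lsup_eq L, ?_⟩
  · rw [lsup_eq]
    exact le_iSup (fun j : Fin L.length => ballSpace M (L.get j).1 (L.get j).2) j
      (self_mem_ball _ _ _)
  · intro j
    apply OrthS.disjoint hB
    refine OrthS.iSup fun i => OrthS.iSup fun hij => ?_
    rw [POrth, List.pairwise_iff_get] at h
    rcases lt_or_gt_of_ne hij with h1 | h1
    · exact (h _ _ h1).symm hB
    · exact h _ _ h1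

end partThree

section partFour

lemma scale_exists (n r s : ℕ) (ε : ℝ) (hε : 0 < ε) : ∃ b : ℕ, ∀ f : ℕ → ℕ, Monotone f → 1 ≤ f 0 →
    (∀ R ≤ 2 * b, f R ≤ (R + 1) ^ n) → ∃ R, r ≤ R ∧ R ≤ b ∧
      f (2 * R) ≤ (2 * 4 ^ n) * f R ∧ (f (R + s) : ℝ) ≤ (1 + ε) * f R := by
  obtain ⟨t, ht⟩ := pow_unbounded_of_one_lt ((2 * 4 ^ n : ℕ) : ℝ) (show 1 < 1 + ε by linarith)
  set ρ := r + t * s + 1 with hρ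
  set m := (2 * ρ) ^ n with hm
  refine ⟨2 * (ρ * 4 ^ m), fun f hf h0 hb => ?_⟩
  have h1 : ∃ k < m, f (ρ * 4 ^ (k + 1)) ≤ (2 * 4 ^ n) * f (ρ * 4 ^ k) := by
    by_contra hcon
    push Not at hcon
    have h2 : ∀ k ≤ m, (2 * 4 ^ n) ^ k ≤ f (ρ * 4 ^ k) := by
      intro k
      induction k with
      | zero => intro _; simpa using h0.trans (hf (Nat.zero_le _))
      | succ k ih =>
        intro hk
        refine le_trans ?_ (hcon k (by omega)).le
        rw [pow_succ, mul_comm]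
        gcongr
        exact ih (by omega)
    have h3 := (h2 m le_rfl).trans (hb (ρ * 4 ^ m) (by omega))
    have h4 : ρ * 4 ^ m + 1 ≤ 2 * ρ * 4 ^ m := by
      have : 1 ≤ ρ * 4 ^ m := Nat.one_le_iff_ne_zero.2 (by positivity)
      linarith
    have h5 := h3.trans (Nat.pow_le_pow_left h4 n)
    rw [mul_pow, mul_pow, ← hm, ← pow_mul, ← pow_mul, mul_comm n m] at h5
    have h6 := Nat.le_of_mul_le_mul_right h5 (by positivity)
    exact absurd h6 (not_le.2 Nat.lt_two_pow_self)
  obtain ⟨k, hk, hC⟩ := h1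
  set R0 := ρ * 4 ^ k with hR0
  have hR0ρ : ρ ≤ R0 := Nat.le_mul_of_pos_right _ (by positivity)
  have hR0b : R0 ≤ ρ * 4 ^ m := by
    rw [hR0]; gcongr; norm_num
  have h4R : ρ * 4 ^ (k + 1) = 4 * R0 := by rw [hR0, pow_succ]; ring
  rw [h4R] at hC
  have hts : t * s ≤ R0 := by omega
  have h2 : ∃ j < t, (f (R0 + j * s + s) : ℝ) ≤ (1 + ε) * f (R0 + j * s) := by
    by_contra hcon
    push Not at hcon
    have h2 : ∀ j ≤ t, (1 + ε) ^ j * f R0 ≤ f (R0 + j * s) := by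
      intro j
      induction j with
      | zero => intro _; simp
      | succ j ih =>
        intro hj
        have := (hcon j (by omega)).le
        have e : R0 + (j + 1) * s = R0 + j * s + s := by ring
        rw [e]
        refine le_trans ?_ this
        rw [pow_succ, mul_comm _ (1 + ε), mul_assoc]
        have := ih (by omega)
        gcongr
    have h3 := h2 t le_rfl
    have h4 : f (R0 + t * s) ≤ (2 * 4 ^ n) * f R0 := (hf (by omega)).trans hC
    have h5 : (f (R0 + t * s) : ℝ) ≤ ((2 * 4 ^ n : ℕ) : ℝ) * f R0 := by exact_mod_cast h4
    have h6 : (0 : ℝ) < f R0 := by exact_mod_cast h0.trans (hf (Nat.zero_le _))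
    have h7 := le_of_mul_le_mul_right (h3.trans h5) h6
    linarith
  obtain ⟨j, hj, hj2⟩ := h2
  have hjs : j * s ≤ R0 := le_trans (Nat.mul_le_mul_right s hj.le) hts
  refine ⟨R0 + j * s, by omega, by omega, ?_, hj2⟩
  calc f (2 * (R0 + j * s)) ≤ f (4 * R0) := hf (by omega)
    _ ≤ _ := hC
    _ ≤ _ := by gcongr; exact hf (by omega)

variable {n : ℕ} {M : Fin n → Module.End ℂ V} {B : V →ₗ⋆[ℂ] V →ₗ[ℂ] ℂ} {σ : Fin n → Fin n}

lemma exists_orth [FiniteDimensional ℂ V] (U Z : Submodule ℂ V)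
    (h : finrank ℂ Z < finrank ℂ U) : ∃ w ∈ U, w ≠ 0 ∧ ∀ z ∈ Z, B z w = 0 := by
  let bz := Module.finBasis ℂ Z
  let T : U →ₗ[ℂ] (Fin (finrank ℂ Z) → ℂ) :=
    LinearMap.pi fun i => (B (bz i : V)).comp U.subtype
  have hT : LinearMap.ker T ≠ ⊥ := by
    apply LinearMap.ker_ne_bot_of_finrank_lt
    simpa using h
  obtain ⟨⟨w, hw⟩, h1, h2⟩ := Submodule.exists_mem_ne_zero_of_ne_bot hT
  refine ⟨w, hw, fun h0 => h2 (Subtype.ext h0), ?_⟩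
  intro z hz
  have h3 : ∀ i, B (bz i : V) w = 0 := fun i => congrFun h1 i
  have h4 : (⟨z, hz⟩ : Z) = ∑ i, bz.repr ⟨z, hz⟩ i • bz i := (bz.sum_repr _).symm
  have h5 : z = ∑ i, bz.repr ⟨z, hz⟩ i • (bz i : V) := by
    have h6 := congrArg Z.subtype h4
    simp only [map_sum, map_smul, Submodule.subtype_apply] at h6
    exact h6
  rw [h5, map_sum, LinearMap.sum_apply]
  apply Finset.sum_eq_zero
  intro i _
  rw [LinearMap.map_smulₛₗ, LinearMap.smul_apply, h3, smul_zero]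

/-- sup with enlarged radii -/
noncomputable def esup (M : Fin n → Module.End ℂ V) (e : ℕ → ℕ) : List (V × ℕ) → Submodule ℂ V
  | [] => ⊥
  | a :: L => ballSpace M a.1 (e a.2) ⊔ esup M e L

lemma esup_finrank [FiniteDimensional ℂ V] (e : ℕ → ℕ) (L : List (V × ℕ)) :
    finrank ℂ (esup M e L) ≤ dsum M e L := by
  induction L with
  | nil => exact (finrank_bot ℂ V).le
  | cons a L ih => exact (Submodule.finrank_add_le_finrank_add_finrank _ _).trans (by
      rw [dsum]; gcongr)

lemma le_esup (e : ℕ → ℕ) (L : List (V × ℕ)) (a : V × ℕ) (ha : a ∈ L) :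
    ballSpace M a.1 (e a.2) ≤ esup M e L := by
  induction L with
  | nil => simp at ha
  | cons c L ih =>
    rcases List.mem_cons.1 ha with rfl | h
    · exact le_sup_left
    · exact (ih h).trans le_sup_right

/-- candidates -/
structure Cand (M : Fin n → Module.End ℂ V) (B : V →ₗ⋆[ℂ] V →ₗ[ℂ] ℂ) (U : Submodule ℂ V) (b : ℕ)
    (Q : V → ℕ → Prop) (P N : List (V × ℕ)) (w : V) (R : ℕ) : Prop where
  mem : w ∈ U
  ne : w ≠ 0
  le : R ≤ b
  q : Q w R
  op : ∀ a ∈ P, ∀ z ∈ ballSpace M a.1 (a.2 + b), B z w = 0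
  on : ∀ a ∈ N, ∀ z ∈ ballSpace M a.1 (2 * a.2), B z w = 0

structure GInv (M : Fin n → Module.End ℂ V) (B : V →ₗ⋆[ℂ] V →ₗ[ℂ] ℂ) (U : Submodule ℂ V) (b : ℕ)
    (Q : V → ℕ → Prop) (P N : List (V × ℕ)) : Prop where
  orth : POrth M B (N ++ P)
  good : ∀ a ∈ N, a.1 ∈ U ∧ a.1 ≠ 0 ∧ a.2 ≤ b ∧ Q a.1 a.2
  small : ∀ w R, Cand M B U b Q P N w R → ∀ a ∈ N, R ≤ a.2

lemma greedy_step (hB : AdjForm M B σ) {U : Submodule ℂ V} {b : ℕ} {Q : V → ℕ → Prop}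
    {P N : List (V × ℕ)} (h : GInv M B U b Q P N) (hc : ∃ w R, Cand M B U b Q P N w R) :
    ∃ a, GInv M B U b Q P (a :: N) := by
  classical
  obtain ⟨w0, R0, h0⟩ := hc
  let pr : ℕ → Prop := fun R => ∃ w, Cand M B U b Q P N w R
  have hpr : pr (Nat.findGreatest pr b) := Nat.findGreatest_spec h0.le ⟨w0, h0⟩
  have hmax : ∀ w R, Cand M B U b Q P N w R → R ≤ Nat.findGreatest pr b := fun w R hw =>
    Nat.le_findGreatest hw.le ⟨w, hw⟩
  obtain ⟨w, hw⟩ := hpr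
  set R := Nat.findGreatest pr b with hR
  refine ⟨(w, R), ?_, ?_, ?_⟩
  · rw [POrth, List.cons_append, List.pairwise_cons]
    refine ⟨fun a ha => ?_, h.orth⟩
    apply OrthS.symm hB
    apply ball_orth hB
    rcases List.mem_append.1 ha with h1 | h1
    · intro z hz
      apply hw.on a h1 z
      exact ball_mono _ _ (by have := h.small w R hw a h1; omega) hz
    · intro z hz
      apply hw.op a h1 z
      exact ball_mono _ _ (by have := hw.le; omega) hz
  · intro a ha
    rcases List.mem_cons.1 ha with rfl | h1
    · exact ⟨hw.mem, hw.ne, hw.le, hw.q⟩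
    · exact h.good a h1
  · intro w' R' hw' a ha
    have hw'' : Cand M B U b Q P N w' R' :=
      ⟨hw'.mem, hw'.ne, hw'.le, hw'.q, hw'.op, fun a ha => hw'.on a (List.mem_cons_of_mem _ ha)⟩
    rcases List.mem_cons.1 ha with rfl | h1
    · exact hmax _ _ hw''
    · exact h.small _ _ hw'' a h1

lemma length_le_dsum [FiniteDimensional ℂ V] (N : List (V × ℕ)) (h : ∀ a ∈ N, a.1 ≠ 0) :
    N.length ≤ dsum M id N := by
  induction N with
  | nil => simp
  | cons a N ih =>
    rw [List.length_cons, dsum]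
    have h1 := ih fun c hc => h c (List.mem_cons_of_mem _ hc)
    have h2 : 0 < finrank ℂ (ballSpace M a.1 (id a.2)) := by
      rw [Module.finrank_pos_iff_exists_ne_zero]
      exact ⟨⟨a.1, self_mem_ball _ _ _⟩, fun h0 => h a (by simp) (congrArg Subtype.val h0)⟩
    omega

lemma dsum_append (e : ℕ → ℕ) (N P : List (V × ℕ)) :
    dsum M e (N ++ P) = dsum M e N + dsum M e P := by
  induction N with
  | nil => simp [dsum]
  | cons a N ih => rw [List.cons_append, dsum, dsum, ih, add_assoc]

lemma greedy [FiniteDimensional ℂ V] (hB : AdjForm M B σ) (U : Submodule ℂ V) (b : ℕ)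
    (Q : V → ℕ → Prop) (hQ : ∀ w ∈ U, w ≠ 0 → ∃ R ≤ b, Q w R)
    (P : List (V × ℕ)) (hP : POrth M B P) :
    ∃ N, POrth M B (N ++ P) ∧ (∀ a ∈ N, a.1 ∈ U ∧ a.1 ≠ 0 ∧ a.2 ≤ b ∧ Q a.1 a.2) ∧
      finrank ℂ U ≤ dsum M (· + b) P + dsum M (2 * ·) N := by
  have key : ∃ N, GInv M B U b Q P N ∧ ¬ ∃ w R, Cand M B U b Q P N w R := by
    by_contra hcon
    push Not at hcon
    have : ∀ k : ℕ, ∃ N, N.length = k ∧ GInv M B U b Q P N := by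
      intro k
      induction k with
      | zero => exact ⟨[], rfl, by simpa using hP, by simp, by simp⟩
      | succ k ih =>
        obtain ⟨N, h1, h2⟩ := ih
        obtain ⟨a, ha⟩ := greedy_step hB h2 (hcon N h2)
        exact ⟨a :: N, by simp [h1], ha⟩
    obtain ⟨N, h1, h2⟩ := this (finrank ℂ V + 1)
    have h3 := length_le_dsum (M := M) N fun a ha => (h2.good a ha).2.1
    have h4 := dsum_eq hB _ h2.orth
    have h5 := Submodule.finrank_le (lsup M (N ++ P))
    rw [dsum_append] at h4
    omega
  obtain ⟨N, h1, h2⟩ := key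
  refine ⟨N, h1.orth, h1.good, ?_⟩
  by_contra hlt
  push Not at hlt
  apply h2
  have h3 : finrank ℂ (esup M (· + b) P ⊔ esup M (2 * ·) N : Submodule ℂ V) < finrank ℂ U :=
    lt_of_le_of_lt ((Submodule.finrank_add_le_finrank_add_finrank _ _).trans
      (add_le_add (esup_finrank _ _) (esup_finrank _ _))) hlt
  obtain ⟨w, hw, hw0, hwz⟩ := exists_orth (B := B) U _ h3
  obtain ⟨R, hR, hQR⟩ := hQ w hw hw0
  exact ⟨w, R, hw, hw0, hR, hQR,
    fun a ha z hz => hwz z ((le_esup (· + b) P a ha).trans le_sup_left hz),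
    fun a ha z hz => hwz z ((le_esup (2 * ·) N a ha).trans le_sup_right hz)⟩

lemma dsum_le {e e' : ℕ → ℕ} {c : ℝ} (L : List (V × ℕ))
    (h : ∀ a ∈ L, (finrank ℂ (ballSpace M a.1 (e a.2)) : ℝ) ≤
      c * finrank ℂ (ballSpace M a.1 (e' a.2))) : (dsum M e L : ℝ) ≤ c * dsum M e' L := by
  induction L with
  | nil => simp [dsum]
  | cons a L ih =>
    have h1 := h a (by simp)
    have h2 := ih fun c hc => h c (List.mem_cons_of_mem _ hc)
    simp only [dsum]
    push_cast
    linarith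

lemma dsum_mono [FiniteDimensional ℂ V] {e e' : ℕ → ℕ} (he : ∀ x, e x ≤ e' x) (L : List (V × ℕ)) :
    dsum M e L ≤ dsum M e' L := by
  induction L with
  | nil => simp [dsum]
  | cons a L ih =>
    simp only [dsum]
    exact add_le_add (Submodule.finrank_mono (ball_mono _ _ (he _))) ih

end partFour

section partFive

lemma codim_inf {ι : Type*} [FiniteDimensional ℂ V] (f : ι → Module.End ℂ V) (s : Finset ι) :
    finrank ℂ V ≤ finrank ℂ (s.inf fun i => LinearMap.ker (f i) : Submodule ℂ V) +
      ∑ i ∈ s, finrank ℂ (LinearMap.range (f i)) := by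
  classical
  induction s using Finset.induction_on with
  | empty =>
    rw [Finset.inf_empty, finrank_top]
    simp
  | insert a s ha ih =>
    rw [Finset.inf_insert, Finset.sum_insert ha]
    have h1 := Submodule.finrank_sup_add_finrank_inf_eq (LinearMap.ker (f a))
      (s.inf fun i => LinearMap.ker (f i))
    have h2 := LinearMap.finrank_range_add_finrank_ker (f a)
    have h3 := Submodule.finrank_le (LinearMap.ker (f a) ⊔ (s.inf fun i => LinearMap.ker (f i)))
    omega

abbrev Ix (n K : ℕ) := (Σ q : Fin (K + 1), (Fin q → Fin n)) × Fin n × Fin n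

noncomputable def opc {n : ℕ} (M : Fin n → Module.End ℂ V) (K : ℕ) (x : Ix n K) : Module.End ℂ V :=
  (M x.2.1 * M x.2.2 - M x.2.2 * M x.2.1) * wl M (List.ofFn x.1.2)

noncomputable def commU {n : ℕ} (M : Fin n → Module.End ℂ V) (K : ℕ) : Submodule ℂ V :=
  Finset.univ.inf fun x : Ix n K => LinearMap.ker (opc M K x)

lemma commAt_of_mem {n : ℕ} {M : Fin n → Module.End ℂ V} {K : ℕ} {w : V} (h : w ∈ commU M K) :
    CommAt M w K := by
  intro l hl i j
  have h1 : commU M K ≤ LinearMap.ker (opc M K (⟨⟨l.length, by omega⟩, l.get⟩, i, j)) :=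
    Finset.inf_le (Finset.mem_univ _)
  have h2 := h1 h
  rw [LinearMap.mem_ker, opc] at h2
  simp only [List.ofFn_get] at h2
  rw [Module.End.mul_apply, LinearMap.sub_apply, sub_eq_zero] at h2
  exact h2

lemma commU_codim {n : ℕ} [FiniteDimensional ℂ V] (M : Fin n → Module.End ℂ V) (K : ℕ) (t : ℝ)
    (ht : ∀ i j, (finrank ℂ (LinearMap.range (M i * M j - M j * M i)) : ℝ) ≤ t) :
    (finrank ℂ V : ℝ) ≤ finrank ℂ (commU M K) + Fintype.card (Ix n K) * t := by
  have h1 := codim_inf (opc M K) Finset.univ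
  have h2 : ((∑ x : Ix n K, finrank ℂ (LinearMap.range (opc M K x)) : ℕ) : ℝ) ≤
      Fintype.card (Ix n K) * t := by
    push_cast
    rw [← nsmul_eq_mul]
    refine Finset.sum_le_card_nsmul _ _ _ fun x _ => ?_
    refine le_trans ?_ (ht x.2.1 x.2.2)
    exact_mod_cast Submodule.finrank_mono (LinearMap.range_comp_le_range _ _)
  have h3 : (finrank ℂ V : ℝ) ≤ finrank ℂ (commU M K) +
      ((∑ x : Ix n K, finrank ℂ (LinearMap.range (opc M K x)) : ℕ) : ℝ) := by exact_mod_cast h1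
  linarith

noncomputable def Bf (d : ℕ) : (Fin d → ℂ) →ₗ⋆[ℂ] (Fin d → ℂ) →ₗ[ℂ] ℂ :=
  LinearMap.mk₂'ₛₗ (starRingEnd ℂ) (RingHom.id ℂ) (fun x y => star x ⬝ᵥ y)
    (fun x y z => by simp [add_dotProduct]) (fun c x y => by simp [smul_dotProduct])
    (fun x y z => by simp [dotProduct_add]) (fun c x y => by simp [dotProduct_smul])

lemma Bf_apply {d : ℕ} (x y : Fin d → ℂ) : Bf d x y = star x ⬝ᵥ y := rfl

abbrev lin {n d : ℕ} (M : Fin n → Matrix (Fin d) (Fin d) ℂ) : Fin n → Module.End ℂ (Fin d → ℂ) :=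
  fun i => (M i).mulVecLin

open scoped ComplexOrder in
lemma adjForm_mat {n d : ℕ} (M : Fin n → Matrix (Fin d) (Fin d) ℂ) (σ : Fin n → Fin n)
    (hσ : ∀ i, (M i)ᴴ = M (σ i)) : AdjForm (lin M) (Bf d) σ where
  pos x h := by
    rw [Bf_apply] at h
    exact dotProduct_star_self_eq_zero.1 h
  symm x y h := by
    rw [Bf_apply] at h ⊢
    rw [star_dotProduct, h, star_zero]
  adj i x y := by
    simp only [Bf_apply, mulVecLin_apply]
    rw [star_mulVec, dotProduct_mulVec, hσ]
  adj' i x y := by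
    simp only [Bf_apply, mulVecLin_apply]
    rw [star_mulVec, dotProduct_mulVec, ← hσ, conjTranspose_conjTranspose]

def Ach (n r : ℕ) (u : ℝ) : Prop := ∀ (s : ℕ) (ε : ℝ), 0 < ε → ∃ η : ℝ, 0 < η ∧
  ∀ (d : ℕ), 0 < d → ∀ M : Fin n → Matrix (Fin d) (Fin d) ℂ,
    (∀ i j, ((M i * M j - M j * M i).rank : ℝ) / d ≤ η) →
    ∀ σ : Fin n → Fin n, (∀ i, (M i)ᴴ = M (σ i)) →
    ∃ L : List ((Fin d → ℂ) × ℕ), POrth (lin M) (Bf d) L ∧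
      (∀ a ∈ L, r ≤ a.2 ∧ IsRegularBall (lin M) a.1 a.2) ∧
      (dsum (lin M) (· + s) L : ℝ) ≤ (1 + ε) * dsum (lin M) id L ∧
      (1 - u) * d ≤ dsum (lin M) id L

lemma ach_one (n r : ℕ) : Ach n r 1 := fun s ε _ =>
  ⟨1, one_pos, fun d _ M _ σ _ => ⟨[], List.Pairwise.nil, by simp, by simp [dsum], by simp [dsum]⟩⟩

lemma arith_step {x y d u θ ε C : ℝ} (hC : 1 ≤ C) (hd : 0 ≤ d) (hu : 0 ≤ u)
    (hθ : θ ≤ u / 4) (hε : ε ≤ u / 4) (hε0 : 0 ≤ ε) (hx : (1 - u) * d ≤ x) (hxd : x ≤ d)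
    (h : (1 - θ) * d ≤ (1 + ε) * x + C * y) : (1 - (1 - 1 / (2 * C)) * u) * d ≤ x + y := by
  have hC0 : 0 < C := by linarith
  have h1 : (1 - (1 - 1 / (2 * C)) * u) * d = ((C - (C - 1 / 2) * u) * d) / C := by
    field_simp
  rw [h1, div_le_iff₀ hC0]
  have h2 : θ * d ≤ u / 4 * d := mul_le_mul_of_nonneg_right hθ hd
  have h3 : ε * x ≤ u / 4 * d := (mul_le_mul_of_nonneg_left hxd hε0).trans
    (mul_le_mul_of_nonneg_right hε hd)
  have h4 : (C - 1) * ((1 - u) * d) ≤ (C - 1) * x := mul_le_mul_of_nonneg_left hx (by linarith)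
  nlinarith

lemma ach_step (n r : ℕ) (u : ℝ) (hu : 0 < u) (h : Ach n r u) :
    Ach n r ((1 - 1 / (2 * (2 * 4 ^ n))) * u) := by
  intro s ε hε
  obtain ⟨b, hb⟩ := scale_exists n r s ε hε
  obtain ⟨K, hbK, hK⟩ := regular_exists n b
  set K' := max K (2 * b) with hK'
  have hε' : 0 < min ε (u / 4) := lt_min hε (by linarith)
  obtain ⟨η, hη, H⟩ := h (max b s) (min ε (u / 4)) hε'
  set c : ℝ := ((Fintype.card (Ix n K') : ℕ) : ℝ) with hc
  have hc0 : 0 ≤ c := by positivity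
  refine ⟨min η (u / 4 / (c + 1)), lt_min hη (by positivity), ?_⟩
  intro d hd M hM σ hσ
  have hd' : (0 : ℝ) < d := by exact_mod_cast hd
  have hB := adjForm_mat M σ hσ
  obtain ⟨P, hPo, hPr, hPs, hPd⟩ := H d hd M (fun i j => (hM i j).trans (min_le_left _ _)) σ hσ
  set U := commU (lin M) K' with hU
  have hUc : ∀ w ∈ U, CommAt (lin M) w K' := fun w hw => commAt_of_mem hw
  let Q : (Fin d → ℂ) → ℕ → Prop := fun w R => r ≤ R ∧
    finrank ℂ (ballSpace (lin M) w (2 * R)) ≤ (2 * 4 ^ n) * finrank ℂ (ballSpace (lin M) w R) ∧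
    (finrank ℂ (ballSpace (lin M) w (R + s)) : ℝ) ≤ (1 + ε) * finrank ℂ (ballSpace (lin M) w R)
  have hQ : ∀ w ∈ U, w ≠ 0 → ∃ R ≤ b, Q w R := by
    intro w hw hw0
    obtain ⟨R, h1, h2, h3, h4⟩ := hb (fun R => finrank ℂ (ballSpace (lin M) w R))
      (fun R R' hR => Submodule.finrank_mono (ball_mono _ _ hR))
      (by
        rw [Nat.succ_le_iff, Module.finrank_pos_iff_exists_ne_zero]
        exact ⟨⟨w, self_mem_ball _ _ _⟩, fun h0 => hw0 (congrArg Subtype.val h0)⟩)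
      (fun R hR => finrank_ball_le (hUc w hw) (hR.trans (le_max_right _ _)))
    exact ⟨R, h2, h1, h3, h4⟩
  obtain ⟨N, hNo, hNg, hNd⟩ := greedy hB U b Q hQ P hPo
  have hPx : (dsum (lin M) id P : ℝ) ≤ d := by
    have h1 := dsum_eq hB P hPo
    have h2 := Submodule.finrank_le (lsup (lin M) P)
    rw [h1] at h2
    simp only [Module.finrank_fin_fun] at h2
    exact_mod_cast h2
  have hmono : ∀ e, e ≤ max b s → (dsum (lin M) (· + e) P : ℝ) ≤
      (1 + min ε (u / 4)) * dsum (lin M) id P := by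
    intro e he
    refine le_trans ?_ hPs
    exact_mod_cast dsum_mono (fun x => by omega) P
  have hNC : (dsum (lin M) (2 * ·) N : ℝ) ≤ (2 * 4 ^ n) * dsum (lin M) id N := by
    apply dsum_le
    intro a ha
    exact_mod_cast (hNg a ha).2.2.2.2.1
  have hdU := commU_codim (lin M) K' (u / 4 / (c + 1) * d) (by
    intro i j
    have h1 := (hM i j).trans (min_le_right _ _)
    rw [div_le_iff₀ hd'] at h1
    have h2 : lin M i * lin M j - lin M j * lin M i = (M i * M j - M j * M i).mulVecLin := by
      refine LinearMap.ext fun x => ?_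
      simp [lin, Matrix.sub_mulVec]
    rw [h2]
    exact h1)
  rw [Module.finrank_fin_fun, ← hc] at hdU
  have hcu : c * (u / 4 / (c + 1) * d) ≤ u / 4 * d := by
    have : c * (u / 4 / (c + 1) * d) = (c / (c + 1)) * (u / 4 * d) := by field_simp
    rw [this]
    apply mul_le_of_le_one_left (by positivity)
    rw [div_le_one (by positivity)]
    linarith
  refine ⟨N ++ P, hNo, ?_, ?_, ?_⟩
  · intro a ha
    rcases List.mem_append.1 ha with h1 | h1
    · obtain ⟨g1, g2, g3, g4⟩ := hNg a h1
      refine ⟨g4.1, hK (lin M) (Bf d) σ hB a.1 ?_ a.2 g3⟩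
      exact fun l hl => hUc _ g1 l (hl.trans (le_max_left _ _))
    · exact hPr a h1
  · rw [dsum_append, dsum_append]
    push_cast
    have h1 := hmono s (le_max_right _ _)
    have h2 : (dsum (lin M) (· + s) N : ℝ) ≤ (1 + ε) * dsum (lin M) id N :=
      dsum_le N fun a ha => (hNg a ha).2.2.2.2.2
    have h3 : (1 + min ε (u / 4)) * (dsum (lin M) id P : ℝ) ≤ (1 + ε) * dsum (lin M) id P := by
      gcongr; exact min_le_left _ _
    linarith
  · rw [dsum_append]
    push_cast
    rw [add_comm]
    have h1 := hmono b (le_max_left _ _)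
    have h2 : (finrank ℂ U : ℝ) ≤ dsum (lin M) (· + b) P + dsum (lin M) (2 * ·) N := by
      exact_mod_cast hNd
    refine arith_step (θ := u / 4) (ε := min ε (u / 4)) ?_ hd'.le hu.le le_rfl (min_le_right _ _)
      hε'.le hPd hPx ?_
    · have : (1 : ℝ) ≤ 4 ^ n := one_le_pow₀ (by norm_num)
      linarith
    · linarith

lemma ach_pow (n r k : ℕ) : Ach n r ((1 - 1 / (2 * (2 * 4 ^ n))) ^ k) := by
  have hpos : (0 : ℝ) < 1 - 1 / (2 * (2 * 4 ^ n)) := by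
    have : (1 : ℝ) ≤ 4 ^ n := one_le_pow₀ (by norm_num)
    rw [sub_pos, div_lt_one (by positivity)]
    linarith
  induction k with
  | zero => rw [pow_zero]; exact ach_one n r
  | succ k ih =>
    rw [pow_succ, mul_comm]
    exact ach_step n r _ (pow_pos hpos k) ih

end partFive

/-- **Lemma (Ornstein–Weiss type).** Fix `n ∈ ℕ₊`. For every `δ > 0` and `r ∈ ℕ` there is
`η > 0` such that every `η`-commuting `∗`-closed tuple `ℳ` of `d×d` complex matrices admits
an `r`-multi-ballspace `W ⊆ ℂ^d` with `dim W ≥ (1−δ)·d`. -/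
theorem multiball_exists (n : ℕ) (hn : 0 < n) (δ : ℝ) (hδ : 0 < δ) (r : ℕ) :
    ∃ η : ℝ, 0 < η ∧
      ∀ (d : ℕ), 0 < d →
        ∀ M : Fin n → Matrix (Fin d) (Fin d) ℂ,
          (∀ i j, ((M i * M j - M j * M i).rank : ℝ) / d ≤ η) →
          (∀ i, ∃ j, (M i)ᴴ = M j) →
          ∃ W : Submodule ℂ (Fin d → ℂ),
            IsMultiBall (fun i => (M i).mulVecLin) r W ∧
            (1 - δ) * d ≤ (finrank ℂ W : ℝ) := by
  have hlt : (1 : ℝ) - 1 / (2 * (2 * 4 ^ n)) < 1 := by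
    have : (0 : ℝ) < 1 / (2 * (2 * 4 ^ n)) := by positivity
    linarith
  obtain ⟨k, hk⟩ := exists_pow_lt_of_lt_one hδ hlt
  obtain ⟨η, hη, H⟩ := ach_pow n r k 0 1 one_pos
  refine ⟨η, hη, fun d hd M hM hs => ?_⟩
  choose σ hσ using hs
  obtain ⟨L, h1, h2, _, h4⟩ := H d hd M hM σ hσ
  have hB := adjForm_mat M σ hσ
  refine ⟨lsup (lin M) L, isMultiBall_of_list hB r L h1 h2, ?_⟩
  rw [dsum_eq hB L h1]
  refine le_trans ?_ h4
  gcongr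
end
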